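/- arXiv:2006.16200 — 2 statements merged into one kernel-verified Lean document; each statement's English description precedes it below -/
import Mathlib

section
/- There exist absolute constants c > 0 and C > 0 such that for every positive integer k there exists a function f : ℝ → {−1, 1} that is at most (2k+6)-piecewise constant, satisfies E_{z∼N(0,1)}[f(z)·z^t] = 0 for every integer 0 ≤ t ≤ k, and satisfies E_{z∼N(0,1)}[f(z)·ReLU(z)] ≥ c·k^{−C}. -/
open MeasureTheory ProbabilityTheory Real

/-- A function `f : ℝ → ℝ` is `m`-piecewise constant if there exist at most `m - 1`
breakpoints such that `f` is constant on each open interval of their complement. -/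
def PiecewiseConst (m : ℕ) (f : ℝ → ℝ) : Prop :=
  ∃ n : ℕ, n ≤ m - 1 ∧ ∃ z : Fin n → ℝ,
    ∀ x y : ℝ, x ≤ y → (∀ i, z i ∉ Set.Icc x y) → f x = f y

/-- Best `L¹` approximation from a finite-dimensional family exists. -/
theorem exists_best_L1_approx {α V : Type*} [MeasurableSpace α] {μ : Measure α}
    [AddCommGroup V] [Module ℝ V] [FiniteDimensional ℝ V] (φ : V →ₗ[ℝ] (α → ℝ))
    (hφ : ∀ v, Integrable (φ v) μ) {g : α → ℝ} (hg : Integrable g μ) :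
    ∃ a, ∀ b, ∫ x, |g x - φ a x| ∂μ ≤ ∫ x, |g x - φ b x| ∂μ := by
  let T : V →ₗ[ℝ] (α →₁[μ] ℝ) :=
    { toFun := fun v => (hφ v).toL1 (φ v)
      map_add' := fun v w => by
        simp only [map_add]
        exact Integrable.toL1_add _ _ (hφ v) (hφ w)
      map_smul' := fun c v => by
        simp only [map_smul]
        exact Integrable.toL1_smul _ (hφ v) c }
  have hnorm : ∀ v, ‖hg.toL1 g - T v‖ = ∫ x, |g x - φ v x| ∂μ := by
    intro v
    change ‖hg.toL1 g - (hφ v).toL1 (φ v)‖ = _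
    rw [← Integrable.toL1_sub, L1.norm_eq_integral_norm]
    refine integral_congr_ae ?_
    filter_upwards [(hg.sub (hφ v)).coeFn_toL1] with x hx
    rw [hx]
    rfl
  have : ProperSpace (LinearMap.range T) := FiniteDimensional.proper_real _
  obtain ⟨⟨_, a, rfl⟩, ha⟩ := Continuous.exists_forall_le
    (β := LinearMap.range T) (f := fun w => ‖hg.toL1 g - (w : α →₁[μ] ℝ)‖) (by fun_prop) (by
      refine Filter.tendsto_atTop_mono (f := fun w => ‖w‖ + -‖hg.toL1 g‖) (fun w => ?_)
        (Filter.tendsto_atTop_add_const_right _ _ tendsto_norm_cocompact_atTop)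
      have := norm_sub_norm_le (w : α →₁[μ] ℝ) (hg.toL1 g)
      rw [norm_sub_rev] at this
      simpa [sub_eq_add_neg] using this)
  refine ⟨a, fun b => ?_⟩
  rw [← hnorm, ← hnorm]
  exact ha ⟨T b, b, rfl⟩

/-- First-order optimality condition for `L¹` minimization: the sign `s` of a minimizer `h` is
orthogonal to every admissible direction `q`. -/
theorem integral_sign_mul_eq_zero {α : Type*} [MeasurableSpace α] {μ : Measure α}
    {h q s : α → ℝ} (hs : AEStronglyMeasurable s μ) (hh : Integrable h μ) (hq : Integrable q μ)
    (h0 : ∀ᵐ x ∂μ, h x ≠ 0) (hsign : ∀ x, s x = if h x < 0 then -1 else 1)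
    (hmin : ∀ t : ℝ, ∫ x, |h x| ∂μ ≤ ∫ x, |h x + t * q x| ∂μ) :
    ∫ x, s x * q x ∂μ = 0 := by
  have key := hasDerivAt_integral_of_dominated_loc_of_lip (μ := μ) (𝕜 := ℝ)
    (F := fun t x => |h x + t * q x|) (F' := fun x => s x * q x)
    (x₀ := 0) (s := Set.univ) (bound := q) Filter.univ_mem
    (Filter.Eventually.of_forall fun t => (hh.add (hq.const_mul t)).abs.aestronglyMeasurable)
    (by simpa using hh.abs) (hs.mul hq.aestronglyMeasurable)
    (Filter.Eventually.of_forall fun x => by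
      refine LipschitzWith.lipschitzOnWith (LipschitzWith.of_dist_le_mul fun s t => ?_)
      rw [Real.dist_eq, Real.dist_eq]
      refine (abs_abs_sub_abs_le_abs_sub _ _).trans (le_of_eq ?_)
      rw [Real.coe_nnabs, ← abs_mul]
      congr 1
      ring)
    hq
    (by
      filter_upwards [h0] with x hx
      have h1 : HasDerivAt (fun t : ℝ => h x + t * q x) (q x) 0 := by
        simpa using ((hasDerivAt_id (0 : ℝ)).mul_const (q x)).const_add (h x)
      have h2 : HasDerivAt (fun y : ℝ => |y|) (s x) (h x + 0 * q x) := by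
        rw [zero_mul, add_zero, hsign]
        split_ifs with hneg
        · exact hasDerivAt_abs_neg hneg
        · exact hasDerivAt_abs_pos (lt_of_le_of_ne (not_lt.mp hneg) hx.symm)
      exact h2.comp 0 h1)
  refine IsLocalMin.hasDerivAt_eq_zero (Filter.Eventually.of_forall fun t => ?_) key.2
  simpa using hmin t

/-- `θ ↦ sin (m θ)` is orthogonal to `cos θ ^ j * sin θ` on `[0, π]` when `j + 1 < m`. -/
theorem integral_cos_pow_mul_sin_mul_sin (j m : ℕ) (hm : j + 1 < m) :
    ∫ θ in (0 : ℝ)..π, sin (m * θ) * (cos θ ^ j * sin θ) = 0 := by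
  induction j generalizing m with
  | zero =>
    have h : ∀ θ : ℝ, sin (m * θ) * (cos θ ^ 0 * sin θ)
        = 2⁻¹ * cos ((m - 1 : ℝ) * θ) - 2⁻¹ * cos ((m + 1 : ℝ) * θ) := fun θ => by
      rw [sub_mul, add_mul, one_mul, cos_sub, cos_add]
      ring
    have h1 : (m - 1 : ℝ) ≠ 0 := by
      have : (1 : ℝ) < m := by exact_mod_cast (by omega : 1 < m)
      linarith
    have h2 : (m + 1 : ℝ) ≠ 0 := by positivity
    simp_rw [h]
    rw [intervalIntegral.integral_sub (Continuous.intervalIntegrable (by fun_prop) _ _)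
      (Continuous.intervalIntegrable (by fun_prop) _ _), intervalIntegral.integral_const_mul,
      intervalIntegral.integral_const_mul, intervalIntegral.integral_comp_mul_left _ h1,
      intervalIntegral.integral_comp_mul_left _ h2, integral_cos, integral_cos]
    have e1 : sin ((m - 1 : ℝ) * π) = 0 := by
      simpa using sin_int_mul_pi ((m : ℤ) - 1)
    have e2 : sin ((m + 1 : ℝ) * π) = 0 := by
      simpa using sin_int_mul_pi ((m : ℤ) + 1)
    simp [e1, e2]
  | succ j ih =>
    have h : ∀ θ : ℝ, sin (m * θ) * (cos θ ^ (j + 1) * sin θ)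
        = 2⁻¹ * (sin ((m + 1 : ℕ) * θ) * (cos θ ^ j * sin θ))
          + 2⁻¹ * (sin ((m - 1 : ℕ) * θ) * (cos θ ^ j * sin θ)) := fun θ => by
      push_cast [Nat.cast_sub (show 1 ≤ m by omega)]
      rw [sub_mul, add_mul, one_mul, sin_sub, sin_add]
      ring
    simp_rw [h]
    rw [intervalIntegral.integral_add (Continuous.intervalIntegrable (by fun_prop) _ _)
      (Continuous.intervalIntegrable (by fun_prop) _ _), intervalIntegral.integral_const_mul,
      intervalIntegral.integral_const_mul, ih _ (by omega), ih _ (by omega)]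
    simp

theorem integral_sin_mul_polynomial_cos (p : Polynomial ℝ) (m : ℕ) (hm : p.natDegree + 1 < m) :
    ∫ θ in (0 : ℝ)..π, sin (m * θ) * (p.eval (cos θ) * sin θ) = 0 := by
  simp_rw [Polynomial.eval_eq_sum_range, Finset.sum_mul, Finset.mul_sum]
  rw [intervalIntegral.integral_finsetSum
    fun i _ => Continuous.intervalIntegrable (by fun_prop) _ _]
  refine Finset.sum_eq_zero fun i hi => ?_
  rw [Finset.mem_range] at hi
  have h : ∀ θ : ℝ, sin (m * θ) * (p.coeff i * cos θ ^ i * sin θ)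
      = p.coeff i * (sin (m * θ) * (cos θ ^ i * sin θ)) := fun θ => by ring
  simp_rw [h]
  rw [intervalIntegral.integral_const_mul, integral_cos_pow_mul_sin_mul_sin i m (by omega),
    mul_zero]

theorem integral_sin_mul_abs_cos (k : ℕ) :
    ∫ θ in (0 : ℝ)..π, sin ((2 * k + 3 : ℕ) * θ) * (|cos θ| * sin θ)
      = (-1) ^ k * (2 / ((2 * k + 1) * (2 * k + 5))) := by
  have hc : Continuous fun θ : ℝ => sin ((2 * k + 3 : ℕ) * θ) * (|cos θ| * sin θ) := by fun_prop
  have hhalf : ∫ θ in (0 : ℝ)..(π / 2), sin ((2 * k + 3 : ℕ) * θ) * (|cos θ| * sin θ)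
      = (-1) ^ k * (1 / ((2 * k + 1) * (2 * k + 5))) := by
    have h : Set.EqOn (fun θ : ℝ => sin ((2 * k + 3 : ℕ) * θ) * (|cos θ| * sin θ))
        (fun θ => 4⁻¹ * cos ((2 * k + 1 : ℝ) * θ) - 4⁻¹ * cos ((2 * k + 5 : ℝ) * θ))
        (Set.uIcc 0 (π / 2)) := fun θ hθ => by
      rw [Set.uIcc_of_le (by positivity)] at hθ
      have hcos : 0 ≤ cos θ := cos_nonneg_of_neg_pi_div_two_le_of_le (by linarith [hθ.1, pi_pos])
        hθ.2
      have e1 : (2 * k + 1 : ℝ) * θ = (2 * k + 3) * θ - 2 * θ := by ring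
      have e2 : (2 * k + 5 : ℝ) * θ = (2 * k + 3) * θ + 2 * θ := by ring
      simp only [abs_of_nonneg hcos]
      push_cast
      rw [e1, e2, cos_sub, cos_add, sin_two_mul]
      ring
    have h1 : (2 * k + 1 : ℝ) ≠ 0 := by positivity
    have h2 : (2 * k + 5 : ℝ) ≠ 0 := by positivity
    rw [intervalIntegral.integral_congr h,
      intervalIntegral.integral_sub (Continuous.intervalIntegrable (by fun_prop) _ _)
      (Continuous.intervalIntegrable (by fun_prop) _ _), intervalIntegral.integral_const_mul,
      intervalIntegral.integral_const_mul, intervalIntegral.integral_comp_mul_left _ h1,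
      intervalIntegral.integral_comp_mul_left _ h2, integral_cos, integral_cos]
    have e1 : sin ((2 * k + 1 : ℝ) * (π / 2)) = (-1) ^ k := by
      rw [show (2 * k + 1 : ℝ) * (π / 2) = π / 2 + k * π by ring, sin_add_nat_mul_pi]
      simp
    have e2 : sin ((2 * k + 5 : ℝ) * (π / 2)) = (-1) ^ k := by
      rw [show (2 * k + 5 : ℝ) * (π / 2) = π / 2 + (k + 2 : ℕ) * π by push_cast; ring,
        sin_add_nat_mul_pi, pow_add]
      simp
    rw [e1, e2]
    simp
    field_simp
    ring
  have hsymm : ∫ θ in (π / 2)..π, sin ((2 * k + 3 : ℕ) * θ) * (|cos θ| * sin θ)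
      = ∫ θ in (0 : ℝ)..(π / 2), sin ((2 * k + 3 : ℕ) * θ) * (|cos θ| * sin θ) := by
    have := intervalIntegral.integral_comp_sub_left (a := 0) (b := π / 2)
      (fun θ : ℝ => sin ((2 * k + 3 : ℕ) * θ) * (|cos θ| * sin θ)) π
    rw [sub_zero, show π - π / 2 = π / 2 by ring] at this
    rw [← this]
    refine intervalIntegral.integral_congr fun θ _ => ?_
    have e : sin ((2 * k + 3 : ℕ) * (π - θ)) = sin ((2 * k + 3 : ℕ) * θ) := by
      rw [mul_sub, sin_nat_mul_pi_sub]
      rw [Odd.neg_one_pow ⟨k + 1, by ring⟩]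
      ring
    simp only [e, cos_pi_sub, sin_pi_sub, abs_neg]
  rw [← intervalIntegral.integral_add_adjacent_intervals (hc.intervalIntegrable _ (π / 2))
    (hc.intervalIntegrable _ _), hsymm, hhalf]
  ring

/-- `L¹` distance from `|x|` to polynomials of degree at most `k` on `[-1, 1]`. -/
theorem le_integral_abs_sub_polynomial (p : Polynomial ℝ) (k : ℕ) (hp : p.natDegree ≤ k) :
    2 / ((2 * k + 1) * (2 * k + 5)) ≤ ∫ x in (-1 : ℝ)..1, |(|x| - p.eval x)| := by
  have hsubst : ∫ x in (-1 : ℝ)..1, |(|x| - p.eval x)|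
      = ∫ θ in (0 : ℝ)..π, |(|cos θ| - p.eval (cos θ))| * sin θ := by
    have := intervalIntegral.integral_comp_mul_deriv (a := 0) (b := π) (f := cos)
      (f' := fun θ => -sin θ) (g := fun x => |(|x| - p.eval x)|)
      (fun θ _ => hasDerivAt_cos θ) (by fun_prop) (by fun_prop)
    rw [cos_zero, cos_pi] at this
    rw [intervalIntegral.integral_symm 1 (-1), ← this, ← intervalIntegral.integral_neg]
    exact intervalIntegral.integral_congr fun θ _ => by simp
  have hval : ∫ θ in (0 : ℝ)..π, sin ((2 * k + 3 : ℕ) * θ) * ((|cos θ| - p.eval (cos θ)) * sin θ)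
      = (-1) ^ k * (2 / ((2 * k + 1) * (2 * k + 5))) := by
    have h : ∀ θ : ℝ, sin ((2 * k + 3 : ℕ) * θ) * ((|cos θ| - p.eval (cos θ)) * sin θ)
        = sin ((2 * k + 3 : ℕ) * θ) * (|cos θ| * sin θ)
          - sin ((2 * k + 3 : ℕ) * θ) * (p.eval (cos θ) * sin θ) := fun θ => by ring
    simp_rw [h]
    rw [intervalIntegral.integral_sub (Continuous.intervalIntegrable (by fun_prop) _ _)
      (Continuous.intervalIntegrable (by fun_prop) _ _), integral_sin_mul_abs_cos,
      integral_sin_mul_polynomial_cos p (2 * k + 3) (by omega), sub_zero]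
  calc (2 : ℝ) / ((2 * k + 1) * (2 * k + 5))
      = |∫ θ in (0 : ℝ)..π,
          sin ((2 * k + 3 : ℕ) * θ) * ((|cos θ| - p.eval (cos θ)) * sin θ)| := by
        rw [hval, abs_mul, abs_pow, abs_neg, abs_one, one_pow, one_mul, abs_of_pos (by positivity)]
    _ ≤ ∫ θ in (0 : ℝ)..π,
          |sin ((2 * k + 3 : ℕ) * θ) * ((|cos θ| - p.eval (cos θ)) * sin θ)| :=
        intervalIntegral.abs_integral_le_integral_abs pi_pos.le
    _ ≤ _ := by
        rw [hsubst]
        refine intervalIntegral.integral_mono_on pi_pos.le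
          (Continuous.intervalIntegrable (by fun_prop) _ _)
          (Continuous.intervalIntegrable (by fun_prop) _ _) fun θ hθ => ?_
        rw [abs_mul, abs_mul, abs_of_nonneg (sin_nonneg_of_mem_Icc hθ)]
        exact mul_le_of_le_one_left (mul_nonneg (abs_nonneg _) (sin_nonneg_of_mem_Icc hθ))
          (abs_sin_le_one _)

theorem integrable_polynomial_gaussianReal (p : Polynomial ℝ) (m : ℝ) (v : NNReal) :
    Integrable (fun x => p.eval x) (gaussianReal m v) := by
  simp_rw [Polynomial.eval_eq_sum_range]
  refine integrable_finsetSum _ fun i _ => Integrable.const_mul ?_ _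
  have := (memLp_id_gaussianReal (μ := m) (v := v) i).integrable_norm_pow'
  simp only [id] at this
  refine (integrable_norm_iff (by fun_prop)).mp ?_
  simpa using this

/-- The `L¹` norm over the standard Gaussian dominates the `L¹` norm on `[-1, 1]`. -/
theorem integral_Icc_le_integral_gaussianReal {g : ℝ → ℝ} (hg : Continuous g)
    (hg0 : ∀ x, 0 ≤ g x) (hint : Integrable g (gaussianReal 0 1)) :
    gaussianPDFReal 0 1 1 * ∫ x in (-1 : ℝ)..1, g x ≤ ∫ x, g x ∂(gaussianReal 0 1) := by
  have hint' : Integrable (fun x => gaussianPDFReal 0 1 x • g x) := by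
    rw [gaussianReal_of_var_ne_zero _ one_ne_zero, integrable_withDensity_iff_integrable_smul'
      (measurable_gaussianPDF _ _) (Filter.Eventually.of_forall fun _ => gaussianPDF_lt_top)] at hint
    simpa using hint
  rw [integral_gaussianReal_eq_integral_smul one_ne_zero, ← intervalIntegral.integral_const_mul,
    intervalIntegral.integral_of_le (by norm_num)]
  refine le_trans ?_ (setIntegral_le_integral (s := Set.Ioc (-1) 1) hint'
    (Filter.Eventually.of_forall fun x => mul_nonneg (gaussianPDFReal_nonneg _ _ _) (hg0 x)))
  refine setIntegral_mono_on ?_ hint'.integrableOn measurableSet_Ioc fun x hx => ?_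
  · exact (Continuous.integrableOn_Icc (by fun_prop)).mono_set Set.Ioc_subset_Icc_self
  · refine mul_le_mul_of_nonneg_right ?_ (hg0 x)
    have hx2 : x ^ 2 ≤ 1 := (sq_le_one_iff_abs_le_one x).mpr (abs_le.mpr ⟨hx.1.le, hx.2⟩)
    refine mul_le_mul_of_nonneg_left (exp_le_exp.mpr ?_) (by positivity)
    simp only [NNReal.coe_one]
    linarith

theorem integral_gaussianReal_eq_zero_of_odd {g : ℝ → ℝ} (hg : ∀ x, g (-x) = -g x) :
    ∫ x, g x ∂(gaussianReal 0 1) = 0 := by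
  have h : ∫ x, g x ∂(gaussianReal 0 1) = ∫ x, g (-x) ∂(gaussianReal 0 1) := by
    conv_lhs => rw [← neg_zero, ← gaussianReal_map_neg]
    exact (MeasurableEquiv.neg ℝ).measurableEmbedding.integral_map g
  simp_rw [hg, integral_neg] at h
  linarith

/-- `|x| - p (x ^ 2)` has at most `2 k` zeros when `2 * deg p ≤ k` and `0 < k`. -/
theorem exists_finset_zeros_abs_sub (p : Polynomial ℝ) (k : ℕ) (hk : 0 < k)
    (hp : p.natDegree * 2 ≤ k) :
    ∃ Z : Finset ℝ, Z.card ≤ 2 * k ∧ ∀ x, |x| - p.eval (x ^ 2) = 0 → x ∈ Z := by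
  set Q : Polynomial ℝ := Polynomial.X - Polynomial.expand ℝ 2 p with hQ
  have hQ0 : Q ≠ 0 := fun h => by
    have := congrArg (fun r : Polynomial ℝ => r.coeff 1) h
    simp [hQ, Polynomial.coeff_expand] at this
  have hdeg : Q.natDegree ≤ k := by
    refine (Polynomial.natDegree_sub_le _ _).trans (max_le ?_ ?_)
    · rw [Polynomial.natDegree_X]
      exact hk
    · rwa [Polynomial.natDegree_expand]
  have hcard : Q.roots.toFinset.card ≤ k :=
    (Multiset.toFinset_card_le _).trans ((Polynomial.card_roots' Q).trans hdeg)
  classical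
  refine ⟨Q.roots.toFinset ∪ Q.roots.toFinset.image (fun x => -x), ?_, fun x hx => ?_⟩
  · refine (Finset.card_union_le _ _).trans ?_
    have := (Finset.card_image_le (s := Q.roots.toFinset) (f := fun x : ℝ => -x))
    omega
  · have hroot : |x| ∈ Q.roots.toFinset := by
      rw [Multiset.mem_toFinset, Polynomial.mem_roots hQ0, Polynomial.IsRoot.def]
      simpa [hQ, Polynomial.expand_eval] using hx
    rcases abs_choice x with h | h
    · exact Finset.mem_union_left _ (h ▸ hroot)
    · refine Finset.mem_union_right _ (Finset.mem_image.mpr ⟨|x|, hroot, ?_⟩)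
      rw [h, neg_neg]

/-- The sign of a continuous function whose zeros lie in a finite set is piecewise constant. -/
theorem piecewiseConst_sign {h : ℝ → ℝ} (hh : Continuous h) (Z : Finset ℝ)
    (hZ : ∀ x, h x = 0 → x ∈ Z) {m : ℕ} (hm : Z.card ≤ m - 1) :
    PiecewiseConst m (fun x => if h x < 0 then -1 else 1) := by
  refine ⟨Z.card, hm, fun i => Z.equivFin.symm i, fun x y hxy hi => ?_⟩
  have hne : ∀ w ∈ Set.Icc x y, h w ≠ 0 := fun w hw h0 => by
    apply hi (Z.equivFin ⟨w, hZ w h0⟩)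
    simpa using hw
  have hiff : h x < 0 ↔ h y < 0 := by
    constructor <;> intro hlt <;> by_contra hge
    · obtain ⟨w, hw, hw0⟩ := intermediate_value_Icc hxy hh.continuousOn
        ⟨hlt.le, not_lt.mp hge⟩
      exact hne w hw hw0
    · obtain ⟨w, hw, hw0⟩ := intermediate_value_Icc' hxy hh.continuousOn
        ⟨hlt.le, not_lt.mp hge⟩
      exact hne w hw hw0
  simp only [hiff]

/-- Best `L¹` approximation of `|x|` by even polynomials under the standard Gaussian. -/
theorem exists_best_even_polynomial_abs (d : ℕ) :
    ∃ p : Polynomial ℝ, p.natDegree ≤ d ∧ ∀ q : Polynomial ℝ, q.natDegree ≤ d →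
      ∫ x, |(|x| - p.eval (x ^ 2))| ∂(gaussianReal 0 1)
        ≤ ∫ x, |(|x| - q.eval (x ^ 2))| ∂(gaussianReal 0 1) := by
  have hfin : FiniteDimensional ℝ (Polynomial.degreeLT ℝ (d + 1)) :=
    Module.Finite.equiv (Polynomial.degreeLTEquiv ℝ (d + 1)).symm
  have hmem : ∀ q : Polynomial ℝ, q ∈ Polynomial.degreeLT ℝ (d + 1) ↔ q.natDegree ≤ d := by
    intro q
    rw [Polynomial.degreeLT_succ_eq_degreeLE, Polynomial.mem_degreeLE,
      Polynomial.natDegree_le_iff_degree_le]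
  obtain ⟨p, hp⟩ := exists_best_L1_approx (μ := gaussianReal 0 1) (g := fun x : ℝ => |x|)
    (LinearMap.pi fun x : ℝ =>
      (Polynomial.leval (x ^ 2)).comp (Polynomial.degreeLT ℝ (d + 1)).subtype)
    (fun v => by
      simpa [Polynomial.expand_eval] using!
        integrable_polynomial_gaussianReal (Polynomial.expand ℝ 2 v) 0 1)
    (by simpa using (integrable_polynomial_gaussianReal Polynomial.X 0 1).abs)
  exact ⟨p, (hmem p).mp p.2, fun q hq => hp ⟨q, (hmem q).mpr hq⟩⟩

/-- There are absolute constants `c, C > 0` such that for every `k ≥ 1` there exists an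
at most `(2k+6)`-piecewise constant `f : ℝ → {-1, 1}` whose Gaussian moments of degree
`≤ k` all vanish and with `E_{z ∼ N(0,1)}[f(z) · ReLU(z)] ≥ c k^(-C)`. -/
theorem stmt7 :
    ∃ c C : ℝ, 0 < c ∧ 0 < C ∧ ∀ k : ℕ, 0 < k →
      ∃ f : ℝ → ℝ, (∀ z, f z = 1 ∨ f z = -1) ∧ PiecewiseConst (2 * k + 6) f ∧
        (∀ t : ℕ, t ≤ k → ∫ z, f z * z ^ t ∂(gaussianReal 0 1) = 0) ∧
        c * (k : ℝ) ^ (-C) ≤ ∫ z, f z * max z 0 ∂(gaussianReal 0 1) := by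
  have hφ : 0 < gaussianPDFReal 0 1 1 := gaussianPDFReal_pos _ _ _ one_ne_zero
  refine ⟨gaussianPDFReal 0 1 1 / 21, 2, by positivity, two_pos, fun k hk => ?_⟩
  obtain ⟨p, hpd, hbest⟩ := exists_best_even_polynomial_abs (k / 2)
  have hpk : p.natDegree * 2 ≤ k := by omega
  obtain ⟨Z, hZcard, hZ⟩ := exists_finset_zeros_abs_sub p k hk hpk
  set h : ℝ → ℝ := fun x => |x| - p.eval (x ^ 2) with hh
  have hcont : Continuous h := by fun_prop
  have habs : Integrable (fun x : ℝ => |x|) (gaussianReal 0 1) := by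
    simpa using (integrable_polynomial_gaussianReal Polynomial.X 0 1).abs
  have hint_even : ∀ q : Polynomial ℝ, Integrable (fun x => q.eval (x ^ 2)) (gaussianReal 0 1) :=
    fun q => by
      simpa [Polynomial.expand_eval] using
        integrable_polynomial_gaussianReal (Polynomial.expand ℝ 2 q) 0 1
  have hint : Integrable h (gaussianReal 0 1) := habs.sub (hint_even p)
  have hne : ∀ᵐ x ∂(gaussianReal 0 1), h x ≠ 0 := by
    refine (gaussianReal_absolutelyContinuous 0 one_ne_zero).ae_le (ae_iff.mpr ?_)
    refine measure_mono_null (t := (Z : Set ℝ)) (fun x hx => hZ x (by simpa using hx)) ?_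
    exact Z.finite_toSet.measure_zero _
  set f : ℝ → ℝ := fun x => if h x < 0 then -1 else 1 with hf
  have hfm : AEStronglyMeasurable f (gaussianReal 0 1) :=
    (Measurable.ite (measurableSet_lt hcont.measurable measurable_const) measurable_const
      measurable_const).aestronglyMeasurable
  have hfeven : ∀ x, f (-x) = f x := fun x => by simp [hf, hh]
  have hfbound : ∀ᵐ x ∂(gaussianReal 0 1), ‖f x‖ ≤ 1 := Filter.Eventually.of_forall fun x => by
    simp only [hf]
    split_ifs <;> simp
  have horth_even : ∀ q : Polynomial ℝ, q.natDegree ≤ k / 2 →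
      ∫ x, f x * q.eval (x ^ 2) ∂(gaussianReal 0 1) = 0 := fun q hq => by
    refine integral_sign_mul_eq_zero hfm hint (hint_even q) hne (fun _ => rfl) fun t => ?_
    refine (hbest (p - Polynomial.C t * q) ?_).trans (le_of_eq ?_)
    · exact (Polynomial.natDegree_sub_le _ _).trans
        (max_le hpd ((Polynomial.natDegree_C_mul_le _ _).trans hq))
    · refine integral_congr_ae (Filter.Eventually.of_forall fun x => ?_)
      simp only [hh, Polynomial.eval_sub, Polynomial.eval_mul, Polynomial.eval_C]
      congr 1
      ring
  have hmoments : ∀ t : ℕ, t ≤ k → ∫ z, f z * z ^ t ∂(gaussianReal 0 1) = 0 := fun t ht => by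
    rcases Nat.even_or_odd' t with ⟨j, rfl | rfl⟩
    · simpa [pow_mul] using horth_even (Polynomial.X ^ j) (by simp; omega)
    · refine integral_gaussianReal_eq_zero_of_odd fun x => ?_
      rw [hfeven, Odd.neg_pow ⟨j, rfl⟩, mul_neg]
  refine ⟨f, fun z => ?_, piecewiseConst_sign hcont Z hZ (by omega), hmoments, ?_⟩
  · simp only [hf]
    split_ifs <;> simp
  have hrelu : ∫ z, f z * max z 0 ∂(gaussianReal 0 1)
      = 2⁻¹ * ∫ z, |h z| ∂(gaussianReal 0 1) := by
    have hid : Integrable (fun x : ℝ => x) (gaussianReal 0 1) := by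
      simpa using integrable_polynomial_gaussianReal Polynomial.X 0 1
    have hdecomp : ∀ z, f z * max z 0
        = 2⁻¹ * |h z| + (2⁻¹ * (f z * p.eval (z ^ 2)) + 2⁻¹ * (f z * z)) := fun z => by
      have h1 : |h z| = f z * h z := by
        simp only [hf]
        split_ifs with hneg
        · rw [abs_of_neg hneg]
          ring
        · rw [abs_of_nonneg (not_lt.mp hneg), one_mul]
      have h2 : max z 0 = 2⁻¹ * (z + |z|) := by
        rcases le_total z 0 with hz | hz
        · rw [max_eq_right hz, abs_of_nonpos hz]
          ring
        · rw [max_eq_left hz, abs_of_nonneg hz]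
          ring
      rw [h1, h2]
      simp only [hh]
      ring
    have i2 : Integrable (fun z => 2⁻¹ * (f z * p.eval (z ^ 2))) (gaussianReal 0 1) :=
      ((hint_even p).bdd_mul hfm hfbound).const_mul _
    have i3 : Integrable (fun z => 2⁻¹ * (f z * z)) (gaussianReal 0 1) :=
      (hid.bdd_mul hfm hfbound).const_mul _
    have hm1 : ∫ z, f z * z ∂(gaussianReal 0 1) = 0 := by simpa using hmoments 1 hk
    simp_rw [hdecomp]
    rw [integral_add (hint.abs.const_mul _) (by exact i2.add i3), integral_add i2 i3, integral_const_mul,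
      integral_const_mul, integral_const_mul, horth_even p hpd, hm1]
    simp
  have hlow : 2 / ((2 * k + 1) * (2 * k + 5)) ≤ ∫ x in (-1 : ℝ)..1, |h x| := by
    simpa [hh, Polynomial.expand_eval] using
      le_integral_abs_sub_polynomial (Polynomial.expand ℝ 2 p) k
        (by rwa [Polynomial.natDegree_expand])
  have hk1 : (1 : ℝ) ≤ k := by exact_mod_cast hk
  have hrate : 2 / 21 * (k : ℝ) ^ (-2 : ℝ) ≤ 2 / ((2 * k + 1) * (2 * k + 5)) := by
    rw [Real.rpow_neg (by positivity), Real.rpow_two, ← div_eq_mul_inv, div_div]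
    refine div_le_div_of_nonneg_left (by norm_num) (by positivity) ?_
    nlinarith
  have hgauss := integral_Icc_le_integral_gaussianReal hcont.abs (fun x => abs_nonneg _) hint.abs
  have := mul_le_mul_of_nonneg_left (hrate.trans hlow) hφ.le
  rw [hrelu]
  linarith
end

section
/- There exist absolute constants c > 0, C > 0 and C' > 0 such that for every positive integer k and every ε > 0 there exists a function G : ℝ → {−1, 1} that is m-piecewise constant for some positive integer m, satisfies |E_{z∼N(0,1)}[G(z)·z^t]| ≤ ε for every integer 0 ≤ t ≤ k, and satisfies E_{z∼N(0,1)}[G(z)·ReLU(z)] ≥ c·k^{−C} − C'·ε. -/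
open MeasureTheory ProbabilityTheory Real

/-- `f` is constant on every interval avoiding the finite set `Z`. -/
def ConstOff (Z : Finset ℝ) (f : ℝ → ℝ) : Prop :=
  ∀ x y : ℝ, x ≤ y → (∀ z ∈ Z, z ∉ Set.Icc x y) → f x = f y

lemma ConstOff.piecewiseConst {Z : Finset ℝ} {f : ℝ → ℝ} (h : ConstOff Z f) :
    PiecewiseConst (Z.card + 1) f := by
  refine ⟨Z.card, by simp, fun i => (Z.equivFin.symm i : ℝ), fun x y hxy hz => h x y hxy ?_⟩
  intro z hz'
  simpa using hz (Z.equivFin ⟨z, hz'⟩)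

lemma ConstOff.ite {Z₁ Z₂ : Finset ℝ} {f₁ f₂ : ℝ → ℝ} (h₁ : ConstOff Z₁ f₁)
    (h₂ : ConstOff Z₂ f₂) (b : ℝ) :
    ConstOff (insert b (Z₁ ∪ Z₂)) (fun x => if x < b then f₁ x else f₂ x) := by
  intro x y hxy hz
  have hb := hz b (by simp)
  have e₁ := h₁ x y hxy fun z hz' => hz z (by simp [hz'])
  have e₂ := h₂ x y hxy fun z hz' => hz z (by simp [hz'])
  rw [Set.mem_Icc, not_and_or, not_le, not_le] at hb
  rcases hb with hb | hb
  · simp [hb.not_gt, (hb.trans_le hxy).not_gt, e₂]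
  · simp [hb, hxy.trans_lt hb, e₁]

/-- A measurable sign function that is piecewise constant. -/
structure IsSignStep (G : ℝ → ℝ) : Prop where
  measurable : Measurable G
  sign : ∀ x, G x = 1 ∨ G x = -1
  constOff : ∃ Z, ConstOff Z G

lemma IsSignStep.one : IsSignStep fun _ => 1 :=
  ⟨measurable_const, fun _ => Or.inl rfl, ∅, fun _ _ _ _ => rfl⟩

lemma IsSignStep.neg_one : IsSignStep fun _ => -1 :=
  ⟨measurable_const, fun _ => Or.inr rfl, ∅, fun _ _ _ _ => rfl⟩

lemma IsSignStep.ite {G₁ G₂ : ℝ → ℝ} (h₁ : IsSignStep G₁) (h₂ : IsSignStep G₂) (b : ℝ) :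
    IsSignStep fun x => if x < b then G₁ x else G₂ x where
  measurable := Measurable.ite measurableSet_Iio h₁.measurable h₂.measurable
  sign x := by
    split_ifs
    exacts [h₁.sign x, h₂.sign x]
  constOff := by
    obtain ⟨Z₁, hZ₁⟩ := h₁.constOff
    obtain ⟨Z₂, hZ₂⟩ := h₂.constOff
    exact ⟨_, hZ₁.ite hZ₂ b⟩

lemma IsSignStep.norm_eq_one {G : ℝ → ℝ} (hG : IsSignStep G) (x : ℝ) : ‖G x‖ = 1 := by
  rcases hG.sign x with h | h <;> simp [h]

lemma IsSignStep.intervalIntegrable_mul {G f : ℝ → ℝ} (hG : IsSignStep G) {a b : ℝ}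
    (hf : IntervalIntegrable f volume a b) :
    IntervalIntegrable (fun x => G x * f x) volume a b := by
  have := fun (s : Set ℝ) (h : IntegrableOn f s) =>
    Integrable.bdd_mul (c := 1) h hG.measurable.aestronglyMeasurable.restrict
      (Filter.Eventually.of_forall fun x => (hG.norm_eq_one x).le)
  exact ⟨this _ hf.1, this _ hf.2⟩

/-- The two-valued pattern on `[a, a + δ]` with mean value `s`. -/
lemma abs_integral_pattern_sub_le {f p : ℝ → ℝ} (hf : Continuous f) (hp : Continuous p)
    {a δ s η : ℝ} (hδ : 0 ≤ δ) (hs : |s| ≤ 1) (hpa : p a = s * f a)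
    (hfa : ∀ x ∈ Set.Icc a (a + δ), |f x - f a| ≤ η)
    (hpx : ∀ x ∈ Set.Icc a (a + δ), |p x - p a| ≤ η) :
    |∫ x in a..a + δ, ((if x < a + (1 + s) / 2 * δ then 1 else -1) * f x - p x)| ≤
      2 * η * δ := by
  obtain ⟨hs₁, hs₂⟩ := abs_le.1 hs
  set G : ℝ → ℝ := fun x => if x < a + (1 + s) / 2 * δ then 1 else -1 with hGdef
  have hG : IsSignStep G := IsSignStep.one.ite IsSignStep.neg_one _
  have hac : a ≤ a + (1 + s) / 2 * δ := by nlinarith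
  have hcb : a + (1 + s) / 2 * δ ≤ a + δ := by nlinarith
  have hGi : ∀ u v, IntervalIntegrable G volume u v := fun u v => by
    simpa using hG.intervalIntegrable_mul (intervalIntegrable_const (c := (1 : ℝ)))
  have hGint : ∫ x in a..a + δ, G x = s * δ := by
    rw [← intervalIntegral.integral_add_adjacent_intervals (hGi a (a + (1 + s) / 2 * δ)) (hGi _ _)]
    have e₁ : ∫ x in a..a + (1 + s) / 2 * δ, G x = ∫ x in a..a + (1 + s) / 2 * δ, (1 : ℝ) := by
      apply intervalIntegral.integral_congr_Ioo_of_le hac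
      intro x hx
      simp [hGdef, hx.2]
    have e₂ : ∫ x in a + (1 + s) / 2 * δ..a + δ, G x =
        ∫ x in a + (1 + s) / 2 * δ..a + δ, (-1 : ℝ) := by
      apply intervalIntegral.integral_congr
      intro x hx
      rw [Set.uIcc_of_le hcb] at hx
      simp [hGdef, hx.1]
    rw [e₁, e₂]
    simp
    ring
  have key : ∫ x in a..a + δ, (G x * f x - p x) =
      ∫ x in a..a + δ, (G x * (f x - f a) - (p x - p a)) := by
    have e : ∀ x, G x * (f x - f a) - (p x - p a) =
        (G x * f x - p x) - (G x * f a - p a) := fun x => by ring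
    simp_rw [e]
    rw [intervalIntegral.integral_sub (f := fun x => G x * f x - p x)
      (g := fun x => G x * f a - p a)
      ((hG.intervalIntegrable_mul (hf.intervalIntegrable _ _)).sub (hp.intervalIntegrable _ _))
      (((hGi _ _).mul_const _).sub intervalIntegrable_const),
      intervalIntegral.integral_sub ((hGi _ _).mul_const _) intervalIntegrable_const,
      intervalIntegral.integral_mul_const, hGint]
    simp [hpa]
    ring
  rw [key]
  have := intervalIntegral.norm_integral_le_of_norm_le_const (a := a) (b := a + δ) (C := 2 * η)
    (f := fun x => G x * (f x - f a) - (p x - p a)) ?_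
  · simpa [abs_of_nonneg hδ] using this
  · intro x hx
    rw [Set.uIoc_of_le (by linarith)] at hx
    have hx' := Set.Ioc_subset_Icc_self hx
    refine (norm_sub_le _ _).trans ?_
    rw [norm_mul, hG.norm_eq_one, one_mul]
    have := hfa x hx'
    have := hpx x hx'
    simp only [Real.norm_eq_abs]
    linarith

/-- Integrals of finitely many continuous functions against a bounded continuous density
can be matched by a sign step function. -/
lemma exists_isSignStep_integral_approx {ι : Type*} [Fintype ι] {f : ι → ℝ → ℝ} {g : ℝ → ℝ}
    (hf : ∀ i, Continuous (f i)) (hg : Continuous g) (hg₁ : ∀ x, |g x| ≤ 1)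
    {R ε : ℝ} (hR : 0 < R) (hε : 0 < ε) :
    ∃ G, IsSignStep G ∧ ∀ i, |∫ x in -R..R, (G x * f i x - g x * f i x)| ≤ ε := by
  have hF : Continuous fun x => ((fun i => f i x, fun i => g x * f i x) : (ι → ℝ) × (ι → ℝ)) := by
    fun_prop
  have huc := (isCompact_Icc (a := -R) (b := R)).uniformContinuousOn_of_continuous hF.continuousOn
  rw [Metric.uniformContinuousOn_iff_le] at huc
  obtain ⟨δ₀, hδ₀, hδ⟩ := huc (ε / (4 * R)) (by positivity)
  obtain ⟨n, hn⟩ := exists_nat_gt (2 * R / δ₀)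
  have hn₀ : (0 : ℝ) < n := lt_of_le_of_lt (by positivity) hn
  set δ := 2 * R / n with hδdef
  have hδpos : 0 < δ := by positivity
  have hnδ : n * δ = 2 * R := by rw [hδdef]; field_simp
  have hδle : δ ≤ δ₀ := by
    rw [div_lt_iff₀ hδ₀] at hn
    rw [hδdef, div_le_iff₀ hn₀]
    linarith
  have main : ∀ j : ℕ, j ≤ n → ∃ G, IsSignStep G ∧
      ∀ i, |∫ x in -R..(-R + j * δ), (G x * f i x - g x * f i x)| ≤
        2 * (ε / (4 * R)) * δ * j := by
    intro j
    induction j with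
    | zero => exact fun _ => ⟨_, IsSignStep.one, by simp⟩
    | succ j ih =>
      intro hj
      obtain ⟨G, hG, hGi⟩ := ih (by omega)
      set a := -R + j * δ with ha
      have hRa : -R ≤ a := by
        have : 0 ≤ j * δ := by positivity
        linarith
      have haR : a + δ ≤ R := by
        have : ((j : ℝ) + 1) * δ ≤ n * δ := by
          gcongr
          exact_mod_cast hj
        rw [ha]; linarith
      have hb : -R + ((j + 1 : ℕ) : ℝ) * δ = a + δ := by rw [ha]; push_cast; ring
      have hP : IsSignStep fun x => if x < a + (1 + g a) / 2 * δ then (1 : ℝ) else -1 :=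
        IsSignStep.one.ite IsSignStep.neg_one _
      have hH := hG.ite hP a
      refine ⟨_, hH, fun i => ?_⟩
      have hii : ∀ {H : ℝ → ℝ}, IsSignStep H → ∀ u v,
          IntervalIntegrable (fun x => H x * f i x - g x * f i x) volume u v := fun hH u v =>
        (hH.intervalIntegrable_mul ((hf i).intervalIntegrable _ _)).sub
          ((hg.mul (hf i)).intervalIntegrable _ _)
      rw [hb, ← intervalIntegral.integral_add_adjacent_intervals (hii hH _ a) (hii hH _ _)]
      have e₁ : ∫ x in -R..a, ((if x < a then G x else
            if x < a + (1 + g a) / 2 * δ then 1 else -1) * f i x - g x * f i x) =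
          ∫ x in -R..a, (G x * f i x - g x * f i x) := by
        apply intervalIntegral.integral_congr_Ioo_of_le hRa
        intro x hx
        simp [hx.2]
      have e₂ : ∫ x in a..a + δ, ((if x < a then G x else
            if x < a + (1 + g a) / 2 * δ then 1 else -1) * f i x - g x * f i x) =
          ∫ x in a..a + δ, ((if x < a + (1 + g a) / 2 * δ then 1 else -1) * f i x
            - g x * f i x) := by
        apply intervalIntegral.integral_congr
        intro x hx
        rw [Set.uIcc_of_le (by linarith)] at hx
        simp [hx.1]
      have hcl : ∀ x ∈ Set.Icc a (a + δ), |f i x - f i a| ≤ ε / (4 * R) ∧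
          |g x * f i x - g a * f i a| ≤ ε / (4 * R) := by
        intro x hx
        have := hδ x ⟨hRa.trans hx.1, hx.2.trans haR⟩ a ⟨hRa, by linarith⟩ (by
          rw [Real.dist_eq, abs_of_nonneg (by linarith [hx.1])]
          linarith [hx.2])
        rw [Prod.dist_eq, max_le_iff] at this
        exact ⟨(dist_le_pi_dist (fun i => f i x) (fun i => f i a) i).trans this.1,
          (dist_le_pi_dist (fun i => g x * f i x) (fun i => g a * f i a) i).trans this.2⟩
      have hcell := abs_integral_pattern_sub_le (hf i) (hg.mul (hf i)) hδpos.le (hg₁ a) rfl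
        (fun x hx => (hcl x hx).1) (fun x hx => (hcl x hx).2)
      rw [e₁, e₂]
      refine (abs_add_le _ _).trans ((add_le_add (hGi i) hcell).trans_eq ?_)
      push_cast
      ring
  obtain ⟨G, hG, hGi⟩ := main n le_rfl
  refine ⟨G, hG, fun i => ?_⟩
  have := hGi i
  rw [hnδ, show -R + 2 * R = R by ring, mul_assoc, mul_comm δ, hnδ] at this
  refine this.trans_eq ?_
  field_simp
  norm_num

lemma integral_cos_mul_cos_pow (t : ℕ) : ∀ n : ℕ, t < n →
    ∫ θ in (0 : ℝ)..π, cos (n * θ) * cos θ ^ t = 0 := by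
  induction t with
  | zero =>
    intro n hn
    have hn' : (n : ℝ) ≠ 0 := by exact_mod_cast hn.ne'
    simp [intervalIntegral.integral_comp_mul_left (fun x => cos x) hn']
  | succ t ih =>
    intro n hn
    obtain ⟨m, rfl⟩ : ∃ m, n = m + 1 := ⟨n - 1, by omega⟩
    have e : ∀ θ : ℝ, cos ((m + 1 : ℕ) * θ) * cos θ ^ (t + 1) =
        (cos ((m + 2 : ℕ) * θ) * cos θ ^ t + cos (m * θ) * cos θ ^ t) / 2 := by
      intro θ
      have h₁ : ((m + 2 : ℕ) : ℝ) * θ = (m + 1 : ℕ) * θ + θ := by push_cast; ring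
      have h₂ : (m : ℝ) * θ = (m + 1 : ℕ) * θ - θ := by push_cast; ring
      rw [h₁, h₂, cos_add, cos_sub]
      ring
    simp_rw [e]
    rw [intervalIntegral.integral_div, intervalIntegral.integral_add
      (Continuous.intervalIntegrable (by fun_prop) _ _)
      (Continuous.intervalIntegrable (by fun_prop) _ _), ih _ (by omega), ih _ (by omega)]
    simp

/-- The oscillating profile, vanishing outside `[-1, 1]`. -/
noncomputable def chebyshevSine (N : ℕ) (x : ℝ) : ℝ := sin (N * arccos x)

lemma continuous_chebyshevSine (N : ℕ) : Continuous (chebyshevSine N) :=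
  continuous_sin.comp (continuous_const.mul continuous_arccos)

lemma chebyshevSine_eq_zero (N : ℕ) {x : ℝ} (hx : 1 ≤ |x|) : chebyshevSine N x = 0 := by
  rcases le_abs'.1 hx with h | h
  · simp [chebyshevSine, arccos_of_le_neg_one h, sin_nat_mul_pi]
  · simp [chebyshevSine, arccos_of_one_le h]

lemma chebyshevSine_cos (N : ℕ) {θ : ℝ} (h₀ : 0 ≤ θ) (hπ : θ ≤ π) :
    chebyshevSine N (cos θ) = sin (N * θ) := by
  rw [chebyshevSine, arccos_cos h₀ hπ]

lemma integral_chebyshevSine_mul_of_one_le (N : ℕ) {q : ℝ → ℝ} (hq : Continuous q) {R : ℝ}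
    (hR : 1 ≤ R) : ∫ x in -R..R, chebyshevSine N x * q x =
      ∫ x in -1..1, chebyshevSine N x * q x := by
  have hi : ∀ u v, IntervalIntegrable (fun x => chebyshevSine N x * q x) volume u v := fun u v =>
    ((continuous_chebyshevSine N).mul hq).intervalIntegrable u v
  have h₁ : ∫ x in -R..(-1), chebyshevSine N x * q x = 0 := by
    rw [← intervalIntegral.integral_zero (a := -R) (b := -1) (μ := volume) (E := ℝ)]
    apply intervalIntegral.integral_congr
    intro x hx
    rw [Set.uIcc_of_le (by linarith)] at hx
    simp [chebyshevSine_eq_zero N (le_abs'.2 (Or.inl hx.2))]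
  have h₂ : ∫ x in 1..R, chebyshevSine N x * q x = 0 := by
    rw [← intervalIntegral.integral_zero (a := 1) (b := R) (μ := volume) (E := ℝ)]
    apply intervalIntegral.integral_congr
    intro x hx
    rw [Set.uIcc_of_le (by linarith)] at hx
    simp [chebyshevSine_eq_zero N (le_abs'.2 (Or.inr hx.1))]
  rw [← intervalIntegral.integral_add_adjacent_intervals (hi (-R) (-1)) (hi _ _), h₁,
    ← intervalIntegral.integral_add_adjacent_intervals (hi (-1) 1) (hi _ _), h₂]
  simp

lemma integral_chebyshevSine_mul (N : ℕ) {q : ℝ → ℝ} (hq : Continuous q) {b : ℝ} (hb₀ : 0 ≤ b)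
    (hb : b ≤ π) : ∫ x in cos b..1, chebyshevSine N x * q x =
      ∫ θ in (0 : ℝ)..b, sin (N * θ) * sin θ * q (cos θ) := by
  have := intervalIntegral.integral_comp_mul_deriv (a := 0) (b := b) (f := cos)
    (f' := fun θ => -sin θ) (g := fun x => chebyshevSine N x * q x)
    (fun x _ => hasDerivAt_cos x) (by fun_prop) ((continuous_chebyshevSine N).mul hq)
  rw [intervalIntegral.integral_symm, ← cos_zero, ← this, ← intervalIntegral.integral_neg]
  apply intervalIntegral.integral_congr
  intro θ hθ
  rw [Set.uIcc_of_le hb₀] at hθ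
  simp only [Function.comp, chebyshevSine_cos N hθ.1 (hθ.2.trans hb)]
  ring

lemma integral_chebyshevSine_mul_pow {N t : ℕ} (h : t + 1 < N) :
    ∫ x in -1..1, chebyshevSine N x * x ^ t = 0 := by
  have := integral_chebyshevSine_mul N (continuous_pow t) pi_pos.le le_rfl
  rw [cos_pi] at this
  rw [this]
  obtain ⟨m, rfl⟩ : ∃ m, N = m + 1 := ⟨N - 1, by omega⟩
  have e : ∀ θ : ℝ, sin ((m + 1 : ℕ) * θ) * sin θ * cos θ ^ t =
      (cos (m * θ) * cos θ ^ t - cos ((m + 2 : ℕ) * θ) * cos θ ^ t) / 2 := by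
    intro θ
    have h₁ : ((m + 2 : ℕ) : ℝ) * θ = (m + 1 : ℕ) * θ + θ := by push_cast; ring
    have h₂ : (m : ℝ) * θ = (m + 1 : ℕ) * θ - θ := by push_cast; ring
    rw [h₁, h₂, cos_add, cos_sub]
    ring
  simp_rw [e]
  rw [intervalIntegral.integral_div, intervalIntegral.integral_sub
    (Continuous.intervalIntegrable (by fun_prop) _ _)
    (Continuous.intervalIntegrable (by fun_prop) _ _),
    integral_cos_mul_cos_pow t _ (by omega), integral_cos_mul_cos_pow t _ (by omega)]
  simp

lemma integral_chebyshevSine_mul_relu (k : ℕ) :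
    ∫ x in -1..1, chebyshevSine (4 * k + 3) x * max x 0 =
      1 / ((4 * k + 1) * (4 * k + 5)) := by
  have hc : Continuous fun x : ℝ => max x 0 := by fun_prop
  have hi : ∀ u v, IntervalIntegrable (fun x => chebyshevSine (4 * k + 3) x * max x 0)
      volume u v := fun u v => ((continuous_chebyshevSine _).mul hc).intervalIntegrable u v
  have h₁ : ∫ x in -1..0, chebyshevSine (4 * k + 3) x * max x 0 = 0 := by
    refine (intervalIntegral.integral_congr fun x hx => ?_).trans intervalIntegral.integral_zero
    rw [Set.uIcc_of_le (by linarith)] at hx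
    simp [max_eq_right hx.2]
  rw [← intervalIntegral.integral_add_adjacent_intervals (hi (-1) 0) (hi _ _), h₁, zero_add]
  have := integral_chebyshevSine_mul (4 * k + 3) hc pi_div_two_pos.le (by linarith [pi_pos])
  rw [cos_pi_div_two] at this
  rw [this]
  have e : ∀ θ ∈ Set.uIcc 0 (π / 2), sin ((4 * k + 3 : ℕ) * θ) * sin θ * max (cos θ) 0 =
      (cos ((4 * k + 1) * θ) - cos ((4 * k + 5) * θ)) / 4 := by
    intro θ hθ
    rw [Set.uIcc_of_le pi_div_two_pos.le] at hθ
    rw [max_eq_left (cos_nonneg_of_mem_Icc ⟨by linarith [hθ.1, pi_pos], hθ.2⟩)]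
    have h₁ : (4 * k + 5 : ℝ) * θ = (4 * k + 3 : ℕ) * θ + 2 * θ := by push_cast; ring
    have h₂ : (4 * k + 1 : ℝ) * θ = (4 * k + 3 : ℕ) * θ - 2 * θ := by push_cast; ring
    rw [h₁, h₂, cos_add, cos_sub, sin_two_mul]
    ring
  rw [intervalIntegral.integral_congr e, intervalIntegral.integral_div,
    intervalIntegral.integral_sub (Continuous.intervalIntegrable (by fun_prop) _ _)
    (Continuous.intervalIntegrable (by fun_prop) _ _)]
  have p₁ : (4 * k + 1 : ℝ) ≠ 0 := by positivity
  have p₅ : (4 * k + 5 : ℝ) ≠ 0 := by positivity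
  have s₁ : sin ((4 * k + 1) * (π / 2)) = 1 := by
    rw [show (4 * k + 1 : ℝ) * (π / 2) = π / 2 + k * (2 * π) by ring, sin_add_nat_mul_two_pi,
      sin_pi_div_two]
  have s₅ : sin ((4 * k + 5) * (π / 2)) = 1 := by
    rw [show (4 * k + 5 : ℝ) * (π / 2) = π / 2 + (k + 1 : ℕ) * (2 * π) by push_cast; ring,
      sin_add_nat_mul_two_pi, sin_pi_div_two]
  rw [intervalIntegral.integral_comp_mul_left (fun x => cos x) p₁,
    intervalIntegral.integral_comp_mul_left (fun x => cos x) p₅]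
  simp only [integral_cos, s₁, s₅, smul_eq_mul, mul_zero, sin_zero]
  field_simp
  ring

lemma gaussianPDFReal_zero_one_pos (x : ℝ) : 0 < gaussianPDFReal 0 1 x :=
  gaussianPDFReal_pos 0 1 x one_ne_zero

lemma continuous_gaussianPDFReal_zero_one : Continuous (gaussianPDFReal 0 1) := by
  rw [gaussianPDFReal_def]
  fun_prop

lemma gaussianPDFReal_one_le {x : ℝ} (hx : |x| ≤ 1) :
    gaussianPDFReal 0 1 1 ≤ gaussianPDFReal 0 1 x := by
  simp only [gaussianPDFReal_def]
  have : x ^ 2 ≤ 1 := by simpa using sq_le_one_iff_abs_le_one x |>.2 hx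
  gcongr ?_ * rexp (?_ / ?_)
  simpa using this

lemma exists_isSignStep_gaussian {ι : Type*} [Fintype ι] {q : ι → ℝ → ℝ}
    (hq : ∀ i, Continuous (q i)) (hqi : ∀ i, Integrable (q i) (gaussianReal 0 1)) (N : ℕ)
    {ε : ℝ} (hε : 0 < ε) :
    ∃ G, IsSignStep G ∧ ∀ i, |∫ z, G z * q i z ∂(gaussianReal 0 1) -
      gaussianPDFReal 0 1 1 * ∫ x in -1..1, chebyshevSine N x * q i x| ≤ ε := by
  set φ := gaussianPDFReal 0 1 with hφ
  have hφc : Continuous φ := continuous_gaussianPDFReal_zero_one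
  have hφ₀ : ∀ x, 0 < φ x := gaussianPDFReal_zero_one_pos
  set f : ι → ℝ → ℝ := fun i x => φ x * q i x with hf
  have hfc : ∀ i, Continuous (f i) := fun i => hφc.mul (hq i)
  have hfi : ∀ i, Integrable (f i) := fun i => by
    have := hqi i
    rw [gaussianReal_of_var_ne_zero 0 one_ne_zero, integrable_withDensity_iff_integrable_smul₀'
      (measurable_gaussianPDF _ _).aemeasurable
      (Filter.Eventually.of_forall fun _ => gaussianPDF_lt_top)] at this
    simpa only [toReal_gaussianPDF, smul_eq_mul] using this
  set g : ℝ → ℝ := fun x => φ 1 / φ x * chebyshevSine N x with hg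
  have hgc : Continuous g :=
    (continuous_const.div hφc fun x => (hφ₀ x).ne').mul (continuous_chebyshevSine N)
  have hg₁ : ∀ x, |g x| ≤ 1 := by
    intro x
    rcases le_total 1 |x| with h | h
    · simp [hg, chebyshevSine_eq_zero N h]
    · rw [hg, abs_mul, abs_of_pos (div_pos (hφ₀ 1) (hφ₀ x))]
      exact mul_le_one₀ ((div_le_one (hφ₀ x)).2 (gaussianPDFReal_one_le h)) (abs_nonneg _)
        (abs_sin_le_one _)
  have htail : ∀ᶠ R : ℝ in Filter.atTop, ∀ i,
      (∫ x, |f i x|) - ε / 2 < ∫ x in -R..R, |f i x| := by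
    rw [Filter.eventually_all]
    intro i
    exact (intervalIntegral_tendsto_integral (hfi i).abs Filter.tendsto_neg_atTop_atBot
      Filter.tendsto_id).eventually_const_lt (by linarith)
  obtain ⟨R, hRtail, hR⟩ := (htail.and (Filter.eventually_ge_atTop 1)).exists
  obtain ⟨G, hG, hGi⟩ := exists_isSignStep_integral_approx hfc hgc hg₁
    (zero_lt_one.trans_le hR) (half_pos hε)
  refine ⟨G, hG, fun i => ?_⟩
  have hGf : Integrable fun x => G x * f i x :=
    Integrable.bdd_mul (c := 1) (hfi i) hG.measurable.aestronglyMeasurable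
      (Filter.Eventually.of_forall fun x => (hG.norm_eq_one x).le)
  have e₁ : ∫ z, G z * q i z ∂(gaussianReal 0 1) = ∫ x, G x * f i x := by
    rw [integral_gaussianReal_eq_integral_smul one_ne_zero]
    congr 1 with x
    simp only [hf, hφ, smul_eq_mul]
    ring
  have e₂ : ∫ x in -R..R, g x * f i x =
      φ 1 * ∫ x in -1..1, chebyshevSine N x * q i x := by
    rw [← integral_chebyshevSine_mul_of_one_le N (hq i) hR,
      ← intervalIntegral.integral_const_mul]
    congr 1 with x
    simp only [hf, hg]
    field_simp [(hφ₀ x).ne']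
  have hRR : -R ≤ R := by linarith
  have hsplit : ∀ {u : ℝ → ℝ}, Integrable u →
      ∫ x, u x = (∫ x in -R..R, u x) + ∫ x in (Set.Ioc (-R) R)ᶜ, u x := fun hu => by
    rw [intervalIntegral.integral_of_le hRR, integral_add_compl measurableSet_Ioc hu]
  have htl : |∫ x in (Set.Ioc (-R) R)ᶜ, G x * f i x| ≤ ε / 2 := by
    refine (abs_integral_le_integral_abs).trans ?_
    simp_rw [abs_mul, ← Real.norm_eq_abs, hG.norm_eq_one, one_mul]
    simp_rw [Real.norm_eq_abs]
    have := hRtail i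
    rw [hsplit (hfi i).abs] at this
    linarith
  have hd := hGi i
  rw [intervalIntegral.integral_sub (g := fun x => g x * f i x) hGf.intervalIntegrable
    (Continuous.intervalIntegrable (hgc.mul (hfc i)) _ _), e₂] at hd
  rw [e₁, hsplit hGf]
  rw [abs_le] at *
  constructor <;> linarith [hd.1, hd.2, htl.1, htl.2]

lemma integrable_pow_gaussianReal (t : ℕ) :
    Integrable (fun z : ℝ => z ^ t) (gaussianReal 0 1) := by
  have := (memLp_id_gaussianReal (μ := 0) (v := 1) t).integrable_norm_pow'
  refine this.mono (by fun_prop) (Filter.Eventually.of_forall fun x => ?_)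
  simp

/-- There are absolute constants `c, C, C' > 0` such that for every `k ≥ 1` and `ε > 0`
there exists a piecewise constant `G : ℝ → {-1, 1}` whose Gaussian moments of degree
`≤ k` are at most `ε` in absolute value, and with
`E_{z ∼ N(0,1)}[G(z) · ReLU(z)] ≥ c k^(-C) - C' ε`. -/
theorem stmt9 :
    ∃ c C C' : ℝ, 0 < c ∧ 0 < C ∧ 0 < C' ∧ ∀ k : ℕ, 0 < k → ∀ ε : ℝ, 0 < ε →
      ∃ (m : ℕ) (G : ℝ → ℝ), 0 < m ∧ (∀ z, G z = 1 ∨ G z = -1) ∧ PiecewiseConst m G ∧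
        (∀ t : ℕ, t ≤ k → |∫ z, G z * z ^ t ∂(gaussianReal 0 1)| ≤ ε) ∧
        c * (k : ℝ) ^ (-C) - C' * ε ≤ ∫ z, G z * max z 0 ∂(gaussianReal 0 1) := by
  have hφ₁ := gaussianPDFReal_zero_one_pos 1
  refine ⟨gaussianPDFReal 0 1 1 / 45, 2, 1, by positivity, two_pos, one_pos, fun k hk ε hε => ?_⟩
  let q : Option (Fin (k + 1)) → ℝ → ℝ := fun i z => i.elim (max z 0) fun t => z ^ (t : ℕ)
  have hqc : ∀ i, Continuous (q i) := by
    rintro (_ | t)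
    · exact continuous_id.max continuous_const
    · exact continuous_pow _
  have hqi : ∀ i, Integrable (q i) (gaussianReal 0 1) := by
    rintro (_ | t)
    · simpa [q] using (integrable_pow_gaussianReal 1).pos_part
    · exact integrable_pow_gaussianReal _
  obtain ⟨G, hG, hGq⟩ := exists_isSignStep_gaussian hqc hqi (4 * k + 3) hε
  obtain ⟨Z, hZ⟩ := hG.constOff
  refine ⟨Z.card + 1, G, Nat.succ_pos _, hG.sign, hZ.piecewiseConst, fun t ht => ?_, ?_⟩
  · have := hGq (some ⟨t, by omega⟩)
    simp only [q, Option.elim_some] at this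
    rwa [integral_chebyshevSine_mul_pow (by omega), mul_zero, sub_zero] at this
  · have := hGq none
    simp only [q, Option.elim_none] at this
    rw [integral_chebyshevSine_mul_relu] at this
    have hk₁ : (1 : ℝ) ≤ k := by exact_mod_cast hk
    have hle : gaussianPDFReal 0 1 1 / 45 * (k : ℝ) ^ (-2 : ℝ) ≤
        gaussianPDFReal 0 1 1 * (1 / ((4 * k + 1) * (4 * k + 5))) := by
      rw [rpow_neg (by positivity), rpow_two, ← one_div, div_mul_div_comm, mul_one,
        mul_one_div]
      refine div_le_div_of_nonneg_left hφ₁.le (by positivity) ?_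
      nlinarith
    linarith [(abs_le.1 this).1]
end
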